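/- For a positive integer k, the following are equivalent: (1) grade_U Ext^{i+1}_Λ(M,U) ≥ i for every M in mod Λ and every 1 ≤ i ≤ k−1; (2) Ext^{i−1}_Γ(Ext^{i+1}_Λ(M,U),U) = 0 for every M in mod Λ and every 1 ≤ i ≤ k−1; (1)^op grade_U Ext^{i+1}_Γ(N,U) ≥ i for every N in mod Γ^op and every 1 ≤ i ≤ k−1; (2)^op Ext^{i−1}_Λ(Ext^{i+1}_Γ(N,U),U) = 0 for every N in mod Γ^op and every 1 ≤ i ≤ k−1. -/

import Mathlib

/-! Common definitions: concrete Ext groups (via the canonical free resolution) of a module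
over a ring `R` with coefficients in an `(R,S)`-bimodule `U`, carrying their natural
`S`-module structure; grades, Gorenstein conditions, resolution dimensions, etc. -/

noncomputable section

namespace GorPaper

section Ext

variable (R : Type) [Ring R]

/-- The canonical free cover `R^(M) → M` of a module. -/
def cover (M : Type) [AddCommGroup M] [Module R M] : (M →₀ R) →ₗ[R] M :=
  Finsupp.linearCombination R (_root_.id : M → M)

/-- The syzygy modules of `M` along its canonical free resolution:
`syz R M 0 = M` and `syz R M (n+1) = ker (R^(syz R M n) → syz R M n)`. -/
def syz (M : ModuleCat.{0} R) : ℕ → ModuleCat.{0} R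
  | 0 => M
  | n + 1 => ModuleCat.of R (LinearMap.ker (cover R (syz M n)))

variable {R} in
/-- Functoriality of the free cover. -/
def freeMap {M N : Type} [AddCommGroup M] [Module R M] [AddCommGroup N] [Module R N]
    (f : M →ₗ[R] N) : (M →₀ R) →ₗ[R] (N →₀ R) :=
  Finsupp.lmapDomain R R f

lemma cover_comp_freeMap {M N : Type} [AddCommGroup M] [Module R M] [AddCommGroup N]
    [Module R N] (f : M →ₗ[R] N) : (cover R N).comp (freeMap f) = f.comp (cover R M) := by
  ext a
  simp [cover, freeMap, Finsupp.linearCombination_single]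

lemma freeMap_ker {M N : Type} [AddCommGroup M] [Module R M] [AddCommGroup N] [Module R N]
    (f : M →ₗ[R] N) :
    ∀ x ∈ LinearMap.ker (cover R M), freeMap f x ∈ LinearMap.ker (cover R N) := by
  intro x hx
  have := congrArg (fun g => g x) (cover_comp_freeMap R f)
  simp only [LinearMap.comp_apply] at this
  simp only [LinearMap.mem_ker] at hx ⊢
  rw [this, hx, map_zero]

variable {R} in
/-- The induced map on first syzygies. -/
def kerMap {M N : Type} [AddCommGroup M] [Module R M] [AddCommGroup N] [Module R N]
    (f : M →ₗ[R] N) :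
    ↥(LinearMap.ker (cover R M)) →ₗ[R] ↥(LinearMap.ker (cover R N)) :=
  (freeMap f).restrict (freeMap_ker R f)

variable {R} in
/-- The induced map on `n`-th syzygies. -/
def syzMap {M N : ModuleCat.{0} R} (f : ↥M →ₗ[R] ↥N) :
    ∀ n, ↥(syz R M n) →ₗ[R] ↥(syz R N n)
  | 0 => f
  | n + 1 => kerMap (syzMap f n)

variable (S : Type) [Ring S]
variable (U : Type) [AddCommGroup U] [Module R U] [Module S U] [SMulCommClass R S U]

/-- Precomposition `Hom_R(B,U) → Hom_R(A,U)`, as an `S`-linear map (where the `S`-module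
structures come from the right `S`-structure of the bimodule `U`). -/
def precompS {A B : Type} [AddCommMonoid A] [Module R A] [AddCommMonoid B] [Module R B]
    (t : A →ₗ[R] B) : (B →ₗ[R] U) →ₗ[S] (A →ₗ[R] U) where
  toFun g := g.comp t
  map_add' g h := LinearMap.add_comp _ _ _
  map_smul' s g := LinearMap.smul_comp _ _ _

/-- The submodule of `Hom_R(Ω N, U)` consisting of those homomorphisms which extend to
the free cover of `N`. -/
def ext1Sub (N : Type) [AddCommGroup N] [Module R N] :
    Submodule S (↥(LinearMap.ker (cover R N)) →ₗ[R] U) :=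
  LinearMap.range (precompS R S U (LinearMap.ker (cover R N)).subtype)

/-- `Ext¹_R(N, U)`, as an `S`-module. -/
def Ext1 (N : Type) [AddCommGroup N] [Module R N] : Type :=
  (↥(LinearMap.ker (cover R N)) →ₗ[R] U) ⧸ ext1Sub R S U N

instance (N : Type) [AddCommGroup N] [Module R N] : AddCommGroup (Ext1 R S U N) :=
  inferInstanceAs (AddCommGroup (_ ⧸ ext1Sub R S U N))

instance (N : Type) [AddCommGroup N] [Module R N] : Module S (Ext1 R S U N) :=
  inferInstanceAs (Module S (_ ⧸ ext1Sub R S U N))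

/-- `Ext^n_R(M, U)`, as an `S`-module: `Ext⁰ = Hom_R(M,U)` and
`Ext^{n+1}(M,U) = Ext¹(Ω^n M, U)` (dimension shifting along the canonical free
resolution of `M`). -/
def ExtU (M : ModuleCat.{0} R) : ℕ → Type
  | 0 => ↥M →ₗ[R] U
  | n + 1 => Ext1 R S U ↥(syz R M n)

instance (M : ModuleCat.{0} R) (n : ℕ) : AddCommGroup (ExtU R S U M n) :=
  match n with
  | 0 => inferInstanceAs (AddCommGroup (↥M →ₗ[R] U))
  | n + 1 => inferInstanceAs (AddCommGroup (Ext1 R S U ↥(syz R M n)))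

instance (M : ModuleCat.{0} R) (n : ℕ) : Module S (ExtU R S U M n) :=
  match n with
  | 0 => inferInstanceAs (Module S (↥M →ₗ[R] U))
  | n + 1 => inferInstanceAs (Module S (Ext1 R S U ↥(syz R M n)))

lemma ext1Sub_le_comap {M N : Type} [AddCommGroup M] [Module R M] [AddCommGroup N]
    [Module R N] (f : M →ₗ[R] N) :
    ext1Sub R S U N ≤ (ext1Sub R S U M).comap (precompS R S U (kerMap f)) := by
  rintro g ⟨h, rfl⟩
  exact ⟨precompS R S U (freeMap f) h, LinearMap.ext fun x => rfl⟩

variable {R} in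
/-- Contravariant functoriality of `Ext¹`. -/
def ext1Map {M N : Type} [AddCommGroup M] [Module R M] [AddCommGroup N] [Module R N]
    (f : M →ₗ[R] N) : Ext1 R S U N →ₗ[S] Ext1 R S U M :=
  Submodule.mapQ _ _ (precompS R S U (kerMap f)) (ext1Sub_le_comap R S U f)

variable {R} in
/-- Contravariant functoriality of `Ext^n`: the map
`Ext^n_R(N,U) → Ext^n_R(M,U)` induced by `f : M → N`; it is `S`-linear. -/
def extMap {M N : ModuleCat.{0} R} (f : ↥M →ₗ[R] ↥N) :
    ∀ n, ExtU R S U N n →ₗ[S] ExtU R S U M n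
  | 0 => precompS R S U f
  | n + 1 => ext1Map S U (syzMap f n)

/-- `Ext^n_R(M,U) = 0`. -/
def extVanish (M : ModuleCat.{0} R) (n : ℕ) : Prop :=
  Subsingleton (ExtU R S U M n)

/-- `grade_U M ≥ i` : `Ext^j_R(M,U) = 0` for all `j < i`. -/
def gradeGE (M : ModuleCat.{0} R) (i : ℕ) : Prop :=
  ∀ j < i, extVanish R S U M j

/-- `grade_U M = g` : `grade_U M ≥ g` and `Ext^g_R(M,U) ≠ 0`. -/
def gradeEq (M : ModuleCat.{0} R) (g : ℕ) : Prop :=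
  gradeGE R S U M g ∧ ¬ extVanish R S U M g

/-- `s.grade_U M ≥ i` : `grade_U B ≥ i` for every submodule `B` of `M`. -/
def sgradeGE (M : ModuleCat.{0} R) (i : ℕ) : Prop :=
  ∀ B : Submodule R ↥M, gradeGE R S U (ModuleCat.of R ↥B) i

/-- Membership in `H_g` : `grade_U M = g` and `Ext^i(M,U) = 0` for all `i ≠ g`. -/
def Hmem (M : ModuleCat.{0} R) (g : ℕ) : Prop :=
  gradeEq R S U M g ∧ ∀ i, i ≠ g → extVanish R S U M i

/-- The functor `Ext^i_S(Ext^i_R(-,U),U) : mod R → mod R` preserves monomorphisms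
(on finitely generated modules). -/
def ExtExtMono [SMulCommClass S R U] (i : ℕ) : Prop :=
  ∀ (X Y : ModuleCat.{0} R), Module.Finite R ↥X → Module.Finite R ↥Y →
    ∀ f : ↥X →ₗ[R] ↥Y, Function.Injective f →
      Function.Injective
        (extMap (R := S) (S := R) U
          (M := ModuleCat.of S (ExtU R S U Y i)) (N := ModuleCat.of S (ExtU R S U X i))
          (extMap (S := S) U f i) i)

/-- `M` is `U`-`k`-torsionfree: for (every) finitely generated projective presentation
`P₁ → P₀ → M → 0`, with `X = coker (Hom(P₀,U) → Hom(P₁,U))`, one has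
`Ext^i_S(X, U) = 0` for `1 ≤ i ≤ k`. -/
def Torsionfree [SMulCommClass S R U] (k : ℕ) (M : ModuleCat.{0} R) : Prop :=
  ∀ (P₁ P₀ : ModuleCat.{0} R), Module.Finite R ↥P₁ → Module.Projective R ↥P₁ →
    Module.Finite R ↥P₀ → Module.Projective R ↥P₀ →
    ∀ (f : ↥P₁ →ₗ[R] ↥P₀) (g : ↥P₀ →ₗ[R] ↥M), Function.Surjective g →
      LinearMap.range f = LinearMap.ker g →
      ∀ i, 1 ≤ i → i ≤ k →
        extVanish S R U
          (ModuleCat.of S ((↥P₁ →ₗ[R] U) ⧸ LinearMap.range (precompS R S U f))) i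

end Ext

section Resol

variable (R : Type) [Ring R] (U : Type) [AddCommGroup U] [Module R U]

/-- `A` belongs to `add U`: it is (isomorphic to) a direct summand of a finite direct
sum of copies of `U`. -/
def InAdd (A : ModuleCat.{0} R) : Prop :=
  ∃ (m : ℕ) (i : ↥A →ₗ[R] (Fin m → U)) (p : (Fin m → U) →ₗ[R] ↥A),
    p.comp i = LinearMap.id

/-- `U`-resolution dimension of `A` is at most `n` : there is an exact sequence
`0 → U_n → ⋯ → U_0 → A → 0` with all `U_i` in `add U`. -/
def URdimLE : ℕ → ModuleCat.{0} R → Prop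
  | 0, A => InAdd R U A
  | n + 1, A => ∃ V : ModuleCat.{0} R, InAdd R U V ∧
      ∃ g : ↥V →ₗ[R] ↥A, Function.Surjective g ∧
        URdimLE n (ModuleCat.of R ↥(LinearMap.ker g))

/-- The `U`-resolution dimension of `A`, as an element of `ℕ∞`. -/
def URdim (A : ModuleCat.{0} R) : ℕ∞ :=
  sInf {c : ℕ∞ | ∃ n : ℕ, c = n ∧ URdimLE R U n A}

/-- `M` is a `k`-syzygy module: there is an exact sequence
`0 → M → P_{k-1} → ⋯ → P_0 → X → 0` with all `P_i` finitely generated projective. -/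
def IsSyzygy : ℕ → ModuleCat.{0} R → Prop
  | 0, _ => True
  | k + 1, M => ∃ P : ModuleCat.{0} R, Module.Finite R ↥P ∧ Module.Projective R ↥P ∧
      ∃ f : ↥M →ₗ[R] ↥P, Function.Injective f ∧
        IsSyzygy k (ModuleCat.of R (↥P ⧸ LinearMap.range f))

/-- `M` is a `U`-`k`-syzygy module: there is an exact sequence
`0 → M → X_0 → X_1 → ⋯ → X_{k-1}` with all `X_i` in `add U`. -/
def IsUSyzygy : ℕ → ModuleCat.{0} R → Prop
  | 0, _ => True
  | k + 1, M => ∃ V : ModuleCat.{0} R, InAdd R U V ∧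
      ∃ f : ↥M →ₗ[R] ↥V, Function.Injective f ∧
        IsUSyzygy k (ModuleCat.of R (↥V ⧸ LinearMap.range f))

/-- The injective dimension of `A` is at most `n` : there is an injective resolution
`0 → A → E_0 → ⋯ → E_n → 0`. -/
def injDimLE : ℕ → ModuleCat.{0} R → Prop
  | 0, A => Module.Injective R ↥A
  | n + 1, A => ∃ E : ModuleCat.{0} R, Module.Injective R ↥E ∧
      ∃ f : ↥A →ₗ[R] ↥E, Function.Injective f ∧
        injDimLE n (ModuleCat.of R (↥E ⧸ LinearMap.range f))

/-- The injective dimension of `A`, as an element of `ℕ∞`. -/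
def injDim (A : ModuleCat.{0} R) : ℕ∞ :=
  sInf {c : ℕ∞ | ∃ n : ℕ, c = n ∧ injDimLE R n A}

/-- `A` is a flat `R`-module (equational criterion for flatness, which makes sense
over an arbitrary, possibly noncommutative, ring): every relation in `A` can be
trivialized. -/
def IsFlat (A : Type) [AddCommGroup A] [Module R A] : Prop :=
  ∀ (n : ℕ) (a : Fin n → R) (x : Fin n → A), (∑ i, a i • x i) = 0 →
    ∃ (k : ℕ) (b : Fin n → Fin k → R) (y : Fin k → A),
      (∀ i, x i = ∑ j, b i j • y j) ∧ ∀ j, (∑ i, a i * b i j) = 0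

/-- The flat dimension of `A` is at most `n` : there is a flat resolution
`0 → F_n → ⋯ → F_0 → A → 0`. -/
def flatDimLE : ℕ → ModuleCat.{0} R → Prop
  | 0, A => IsFlat R ↥A
  | n + 1, A => ∃ F : ModuleCat.{0} R, IsFlat R ↥F ∧
      ∃ g : ↥F →ₗ[R] ↥A, Function.Surjective g ∧
        flatDimLE n (ModuleCat.of R ↥(LinearMap.ker g))

/-- `A` is cogenerated by `U` : it embeds into a direct product of copies of `U`. -/
def Cogenerated (A : ModuleCat.{0} R) : Prop :=
  ∃ (ι : Type) (f : ↥A →ₗ[R] (ι → U)), Function.Injective f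

/-- A minimal injective resolution `0 → M → E 0 → E 1 → ⋯` of `M` : an injective
resolution in which the kernel of each differential is an essential submodule. -/
structure MinInjRes (M : Type) [AddCommGroup M] [Module R M] where
  E : ℕ → ModuleCat.{0} R
  injective : ∀ n, Module.Injective R ↥(E n)
  ι : M →ₗ[R] ↥(E 0)
  d : ∀ n, ↥(E n) →ₗ[R] ↥(E (n + 1))
  ι_inj : Function.Injective ι
  exact_zero : LinearMap.ker (d 0) = LinearMap.range ι
  exact_succ : ∀ n, LinearMap.ker (d (n + 1)) = LinearMap.range (d n)
  essential : ∀ n (B : Submodule R ↥(E n)), B ⊓ LinearMap.ker (d n) = ⊥ → B = ⊥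

end Resol

section Bimodule

variable (Λ Γ : Type) [Ring Λ] [Ring Γ]
variable (U : Type) [AddCommGroup U] [Module Λ U] [Module Γᵐᵒᵖ U]
  [SMulCommClass Λ Γᵐᵒᵖ U] [SMulCommClass Γᵐᵒᵖ Λ U]

/-- Left multiplication `u ↦ a • u` as a `Γᵒᵖ`-linear endomorphism of `U`. -/
def lmul (a : Λ) : U →ₗ[Γᵐᵒᵖ] U where
  toFun u := a • u
  map_add' := smul_add a
  map_smul' γ u := smul_comm a γ u

/-- Right multiplication `u ↦ u γ` as a `Λ`-linear endomorphism of `U`. -/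
def rmul (γ : Γᵐᵒᵖ) : U →ₗ[Λ] U where
  toFun u := γ • u
  map_add' := smul_add γ
  map_smul' a u := smul_comm γ a u

/-- `U` is a faithfully balanced `(Λ,Γ)`-bimodule: the natural maps
`Λ → End(U_Γ)` and `Γ → End(_ΛU)^op` are isomorphisms. -/
def FaithfullyBalanced : Prop :=
  Function.Bijective (lmul Λ Γ U) ∧ Function.Bijective (rmul Λ Γ U)

/-- `U` is selforthogonal: `Ext^i_Λ(U,U) = 0 = Ext^i_Γ(U,U)` for all `i ≥ 1`. -/
def SelfOrthogonal : Prop :=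
  (∀ i, 1 ≤ i → extVanish Λ Γᵐᵒᵖ U (ModuleCat.of Λ U) i) ∧
  (∀ i, 1 ≤ i → extVanish Γᵐᵒᵖ Λ U (ModuleCat.of Γᵐᵒᵖ U) i)

/-- `_ΛU` is `k`-Gorenstein : `s.grade_U Ext^i_Γ(N,U) ≥ i` for every
`N ∈ mod Γᵒᵖ` and all `1 ≤ i ≤ k`. -/
def LeftGorenstein (k : ℕ) : Prop :=
  ∀ N : ModuleCat.{0} Γᵐᵒᵖ, Module.Finite Γᵐᵒᵖ ↥N →
    ∀ i, 1 ≤ i → i ≤ k →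
      sgradeGE Λ Γᵐᵒᵖ U (ModuleCat.of Λ (ExtU Γᵐᵒᵖ Λ U N i)) i

/-- `U_Γ` is `k`-Gorenstein : `s.grade_U Ext^i_Λ(M,U) ≥ i` for every
`M ∈ mod Λ` and all `1 ≤ i ≤ k`. -/
def RightGorenstein (k : ℕ) : Prop :=
  ∀ M : ModuleCat.{0} Λ, Module.Finite Λ ↥M →
    ∀ i, 1 ≤ i → i ≤ k →
      sgradeGE Γᵐᵒᵖ Λ U (ModuleCat.of Γᵐᵒᵖ (ExtU Λ Γᵐᵒᵖ U M i)) i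

end Bimodule

section PartP1
open CategoryTheory CategoryTheory.Abelian

/-- Derived-category Ext groups; they carry an `S`-module structure. -/
def E (R : Type) [Ring R] (_S : Type) (U : Type) [AddCommGroup U] [Module R U]
    (M : Type) [AddCommGroup M] [Module R M] (n : ℕ) : Type :=
  Ext.{0} (ModuleCat.of R M) (ModuleCat.of R U) n

section ELayer

variable (R : Type) [Ring R] (S : Type) [Ring S]
variable (U : Type) [AddCommGroup U] [Module R U] [Module S U] [SMulCommClass R S U]

/-- The action of `s : S` on `U`, as an `R`-linear map. -/
def act (s : S) : U →ₗ[R] U where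
  toFun u := s • u
  map_add' := smul_add s
  map_smul' a u := (smul_comm a s u).symm


variable (M : Type) [AddCommGroup M] [Module R M] 

instance (n : ℕ) : AddCommGroup (E R S U M n) :=
  inferInstanceAs (AddCommGroup (Ext.{0} (ModuleCat.of R M) (ModuleCat.of R U) n))

lemma act_add (s t : S) : ModuleCat.ofHom (act R S U (s + t)) =
    ModuleCat.ofHom (act R S U s) + ModuleCat.ofHom (act R S U t) := by
  ext x; simp [act, add_smul]

lemma act_mul (s t : S) : ModuleCat.ofHom (act R S U (s * t)) =
    ModuleCat.ofHom (act R S U t) ≫ ModuleCat.ofHom (act R S U s) := by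
  ext x; simp [act, mul_smul]

lemma act_one : ModuleCat.ofHom (act R S U 1) = 𝟙 (ModuleCat.of R U) := by
  ext x; simp [act]

lemma act_zero : ModuleCat.ofHom (act R S U 0) = 0 := by
  ext x; simp [act]

section aux
variable {M} {n : ℕ} (e : Ext.{0} (ModuleCat.of R M) (ModuleCat.of R U) n)

/-- The action of `S` on a derived-category Ext group. -/
def sm (s : S) : Ext.{0} (ModuleCat.of R M) (ModuleCat.of R U) n :=
  e.comp (Ext.mk₀ (ModuleCat.ofHom (act R S U s))) (add_zero n)

lemma sm_one : sm R S U e 1 = e := by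
  rw [sm, act_one, Ext.comp_mk₀_id]

lemma sm_mul (s t : S) : sm R S U e (s * t) = sm R S U (sm R S U e t) s := by
  rw [sm, sm, sm, act_mul, Ext.comp_assoc_of_third_deg_zero, Ext.mk₀_comp_mk₀]

lemma sm_add (s t : S) : sm R S U e (s + t) = sm R S U e s + sm R S U e t := by
  rw [sm, sm, sm, act_add, Ext.mk₀_add, Ext.comp_add]

lemma sm_addEquiv (e : Ext.{0} (ModuleCat.of R M) (ModuleCat.of R U) 0) (s : S) :
    Ext.addEquiv₀ (sm R S U e s) = Ext.addEquiv₀ e ≫ ModuleCat.ofHom (act R S U s) := by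
  obtain ⟨g, rfl⟩ := Ext.addEquiv₀.symm.surjective e
  rw [AddEquiv.apply_symm_apply, ← AddEquiv.eq_symm_apply]
  exact Ext.mk₀_comp_mk₀ _ _

lemma sm_zero : sm R S U e 0 = 0 := by
  rw [sm, act_zero, Ext.mk₀_zero, Ext.comp_zero]

end aux

instance instModE (n : ℕ) : Module S (E R S U M n) where
  smul s e := sm R S U e s
  one_smul e := sm_one R S U e
  mul_smul s t e := sm_mul R S U e s t
  smul_zero s := Ext.zero_comp _ _ _ _ (add_zero n)
  smul_add s e e2 := Ext.add_comp _ _ _ (add_zero n)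
  add_smul s t e := sm_add R S U e s t
  zero_smul e := sm_zero R S U e

lemma E_smul_def (n : ℕ) (s : S) (e : E R S U M n) : s • e = sm R S U e s := rfl

/-- degree zero -/
def E0 : E R S U M 0 ≃ₗ[S] (M →ₗ[R] U) where
  toFun e := (Ext.addEquiv₀ (e : Ext.{0} (ModuleCat.of R M) (ModuleCat.of R U) 0)).hom
  invFun f := Ext.mk₀ (ModuleCat.ofHom f)
  left_inv e := Ext.mk₀_addEquiv₀_apply _
  right_inv f := by
    have : Ext.addEquiv₀ (Ext.mk₀ (ModuleCat.ofHom f)) = ModuleCat.ofHom f :=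
      Ext.addEquiv₀.apply_symm_apply _
    exact congrArg ModuleCat.Hom.hom this
  map_add' e e' := congrArg ModuleCat.Hom.hom (map_add (Ext.addEquiv₀
    (X := ModuleCat.of R M) (Y := ModuleCat.of R U)) e e')
  map_smul' s e := (congrArg ModuleCat.Hom.hom (sm_addEquiv R S U e s) :)

variable {R M}
variable {A B C : Type} [AddCommGroup A] [Module R A] [AddCommGroup B] [Module R B]
  [AddCommGroup C] [Module R C]

/-- precomposition with an ext class -/
def pre {m n p : ℕ} (x : Ext.{0} (ModuleCat.of R A) (ModuleCat.of R B) m) (h : m + n = p) :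
    E R S U B n →ₗ[S] E R S U A p where
  toFun e := Ext.comp x e h
  map_add' e e' := Ext.comp_add _ _ _ _
  map_smul' s e := by
    exact (Ext.comp_assoc_of_third_deg_zero x e
      (Ext.mk₀ (ModuleCat.ofHom (act R S U s))) h).symm

/-- functoriality -/
def pull (f : A →ₗ[R] B) (n : ℕ) : E R S U B n →ₗ[S] E R S U A n :=
  pre S U (Ext.mk₀ (ModuleCat.ofHom f)) (zero_add n)

lemma pull_id (n : ℕ) (e : E R S U A n) : pull S U (LinearMap.id : A →ₗ[R] A) n e = e := 
  Ext.mk₀_id_comp (X := ModuleCat.of R A) e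

lemma pull_comp (f : A →ₗ[R] B) (g : B →ₗ[R] C) (n : ℕ) (e : E R S U C n) :
    pull S U (g.comp f) n e = pull S U f n (pull S U g n e) := by
  exact (Ext.mk₀_comp_mk₀_assoc (ModuleCat.ofHom f) (ModuleCat.ofHom g) _).symm

lemma pull_add (f g : A →ₗ[R] B) (n : ℕ) (e : E R S U B n) :
    pull S U (f + g) n e = pull S U f n e + pull S U g n e := by
  exact (congrArg (fun x => Ext.comp x e (zero_add n))
    (Ext.mk₀_add (ModuleCat.ofHom f) (ModuleCat.ofHom g))).trans (Ext.add_comp _ _ _ _)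

lemma pull_zero (n : ℕ) (e : E R S U B n) :
    pull S U (0 : A →ₗ[R] B) n e = 0 := by
  exact (congrArg (fun x => Ext.comp x e (zero_add n))
    (Ext.mk₀_zero (X := ModuleCat.of R A) (Y := ModuleCat.of R B))).trans (Ext.zero_comp _ _ _ _ _)

lemma E0_symm_pull (f : A →ₗ[R] B) (g : B →ₗ[R] U) :
    pull S U f 0 ((E0 R S U B).symm g) = (E0 R S U A).symm (g.comp f) := 
  Ext.mk₀_comp_mk₀ _ _

lemma E0_pull (f : A →ₗ[R] B) (e : E R S U B 0) :
    E0 R S U A (pull S U f 0 e) = (E0 R S U B e).comp f := by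
  obtain ⟨g, rfl⟩ := (E0 R S U B).symm.surjective e
  rw [E0_symm_pull]; simp

def pullEquiv (f : A ≃ₗ[R] B) (n : ℕ) : E R S U B n ≃ₗ[S] E R S U A n :=
  LinearEquiv.ofLinearMap (pull S U f.toLinearMap n) (pull S U f.symm.toLinearMap n)
    (by ext e; simp [← pull_comp, pull_id]) (by ext e; simp [← pull_comp, pull_id])

/-- short exactness -/
structure SES (f : A →ₗ[R] B) (g : B →ₗ[R] C) : Prop where
  inj : Function.Injective f
  ex : Function.Exact f g
  surj : Function.Surjective g

variable {f : A →ₗ[R] B} {g : B →ₗ[R] C}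

lemma SES.se (h : SES f g) : (ModuleCat.shortComplexOfCompEqZero f g h.ex.linearMap_comp_eq_zero).ShortExact := 
  ModuleCat.shortComplex_shortExact _ h.ex h.inj h.surj

/-- connecting map -/
def SES.δ (h : SES f g) (n : ℕ) : E R S U A n →ₗ[S] E R S U C (n + 1) :=
  pre S U (h.se.extClass) (add_comm 1 n)

lemma SES.ex2 (h : SES f g) (n : ℕ) (e : E R S U B n) (he : pull S U f n e = 0) :
    ∃ e', pull S U g n e' = e :=
  Ext.contravariant_sequence_exact₂ h.se _ e he

lemma SES.ex1 (h : SES f g) (n : ℕ) (e : E R S U A n) (he : h.δ S U n e = 0) :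
    ∃ e', pull S U f n e' = e :=
  Ext.contravariant_sequence_exact₁ h.se _ e (add_comm 1 n) he

lemma SES.ex3 (h : SES f g) (n : ℕ) (e : E R S U C (n + 1)) (he : pull S U g (n + 1) e = 0) :
    ∃ e', h.δ S U n e' = e :=
  Ext.contravariant_sequence_exact₃ h.se _ e he (add_comm 1 n)

lemma SES.δ_pull (h : SES f g) (n : ℕ) (e : E R S U B n) : h.δ S U n (pull S U f n e) = 0 :=
  h.se.extClass_comp_assoc _ (h := add_comm 1 n)

lemma SES.pull_δ (h : SES f g) (n : ℕ) (e : E R S U A n) :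
    pull S U g (n + 1) (h.δ S U n e) = 0 :=
  h.se.comp_extClass_assoc _ (add_comm 1 n)

set_option linter.unusedSectionVars false in
lemma proj_zero [Module.Projective R A] (n : ℕ) : Subsingleton (E R S U A (n + 1)) := by
  have : Projective (ModuleCat.of R A) := (IsProjective.iff_projective _).1 inferInstance
  exact Ext.subsingleton_of_projective (ModuleCat.of R A) (ModuleCat.of R U) n

lemma sum_zero (n : ℕ) (h : Subsingleton (E R S U A n)) (r : ℕ) (p : Fin r → (B →ₗ[R] A))
    (q : Fin r → (A →ₗ[R] B)) (hid : ∑ i, (q i).comp (p i) = LinearMap.id) :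
    Subsingleton (E R S U B n) := by
  refine subsingleton_of_forall_eq 0 fun e => ?_
  have key : ∀ s : Finset (Fin r), pull S U (∑ i ∈ s, (q i).comp (p i)) n e = 0 := by
    intro s
    induction s using Finset.induction_on with
    | empty =>
      rw [Finset.sum_empty, pull_zero]
    | insert a s ha ih =>
      rw [Finset.sum_insert ha, pull_add, ih, pull_comp, Subsingleton.elim (pull S U _ n e) 0]
      simp
  have := key Finset.univ
  rwa [hid, pull_id] at this

/-- dimension shift -/
def SES.shift (h : SES f g) (n : ℕ) (h1 : Subsingleton (E R S U B n))
    (h2 : Subsingleton (E R S U B (n + 1))) : E R S U A n ≃ₗ[S] E R S U C (n + 1) :=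
  LinearEquiv.ofBijective (h.δ S U n) ⟨by
    rw [injective_iff_map_eq_zero]
    intro e he
    obtain ⟨e', rfl⟩ := h.ex1 S U n e he
    rw [Subsingleton.elim e' 0, map_zero], fun e => h.ex3 S U n e (Subsingleton.elim _ _)⟩

/-- first Ext as cokernel -/
lemma SES.ext1 (h : SES f g) (h2 : Subsingleton (E R S U B 1)) :
    Nonempty (((A →ₗ[R] U) ⧸ LinearMap.range (precompS R S U f)) ≃ₗ[S] E R S U C 1) := by
  let φ : (A →ₗ[R] U) →ₗ[S] E R S U C 1 := (h.δ S U 0).comp (E0 R S U A).symm.toLinearMap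
  have hk : LinearMap.ker φ = LinearMap.range (precompS R S U f) := by
    ext a
    constructor
    · intro ha
      obtain ⟨e', he⟩ := h.ex1 S U 0 _ ha
      refine ⟨E0 R S U B e', ?_⟩
      change (E0 R S U B e').comp f = a
      rw [← E0_pull, he]; simp
    · rintro ⟨b, rfl⟩
      change h.δ S U 0 ((E0 R S U A).symm (b.comp f)) = 0
      rw [← E0_symm_pull, SES.δ_pull]
  have hs : Function.Surjective φ := fun e => by
    obtain ⟨e', he⟩ := h.ex3 S U 0 e (Subsingleton.elim _ _)
    exact ⟨E0 R S U A e', by simp [φ, he]⟩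
  exact ⟨(Submodule.quotEquivOfEq _ _ hk.symm).trans (φ.quotKerEquivOfSurjective hs)⟩

end ELayer

section Cov

variable {R : Type} [Ring R] {T : Type} [AddCommGroup T] [Module R T]
variable {A B C : Type} [AddCommGroup A] [Module R A] [AddCommGroup B] [Module R B]
  [AddCommGroup C] [Module R C]

lemma cov_zero {f : A →ₗ[R] B} {g : B →ₗ[R] C} (h : SES f g) (S : Type) (n : ℕ)
    (h1 : Subsingleton (E R S B T n)) (h2 : Subsingleton (E R S A T (n + 1))) :
    Subsingleton (E R S C T n) := by
  refine subsingleton_of_forall_eq (0 : Ext.{0} (ModuleCat.of R T) (ModuleCat.of R C) n)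
    fun (e : Ext.{0} (ModuleCat.of R T) (ModuleCat.of R C) n) => ?_
  have h1' : Subsingleton (Ext.{0} (ModuleCat.of R T) (ModuleCat.of R B) n) := h1
  have h2' : Subsingleton (Ext.{0} (ModuleCat.of R T) (ModuleCat.of R A) (n + 1)) := h2
  obtain ⟨e', he⟩ := Ext.covariant_sequence_exact₃ (ModuleCat.of R T) h.se e rfl
    (h2'.elim _ _)
  rw [← he]
  have : e' = 0 := h1'.elim _ _
  rw [this, Ext.zero_comp]

lemma cov_sum_zero (S : Type) (n : ℕ) (h : Subsingleton (E R S A T n)) (r : ℕ)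
    (p : Fin r → (B →ₗ[R] A))
    (q : Fin r → (A →ₗ[R] B)) (hid : ∑ i, (q i).comp (p i) = LinearMap.id) :
    Subsingleton (E R S B T n) := by
  have h' : Subsingleton (Ext.{0} (ModuleCat.of R T) (ModuleCat.of R A) n) := h
  refine subsingleton_of_forall_eq (0 : Ext.{0} (ModuleCat.of R T) (ModuleCat.of R B) n)
    fun (e : Ext.{0} (ModuleCat.of R T) (ModuleCat.of R B) n) => ?_
  have key : ∀ s : Finset (Fin r),
      e.comp (Ext.mk₀ (ModuleCat.ofHom (∑ i ∈ s, (q i).comp (p i)))) (add_zero n) = 0 := by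
    intro s
    induction s using Finset.induction_on with
    | empty =>
      rw [Finset.sum_empty]
      exact (congrArg (fun x => Ext.comp e x (add_zero n)) (Ext.mk₀_zero _ _)).trans
        (Ext.comp_zero _ _ _ _ (add_zero n))
    | insert a s ha ih =>
      rw [Finset.sum_insert ha, ModuleCat.ofHom_add, Ext.mk₀_add, Ext.comp_add, ih, add_zero,
        ModuleCat.ofHom_comp, ← Ext.mk₀_comp_mk₀, ← Ext.comp_assoc_of_third_deg_zero,
        Subsingleton.elim (e.comp (Ext.mk₀ (ModuleCat.ofHom (p a))) (add_zero n)) 0, Ext.zero_comp]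
  have := key Finset.univ
  rw [hid] at this
  exact (Ext.comp_mk₀_id e).symm.trans this

end Cov
end PartP1

section PartP2
open CategoryTheory CategoryTheory.Abelian

section Compare

variable (R : Type) [Ring R] (S : Type) [Ring S]
variable (U : Type) [AddCommGroup U] [Module R U] [Module S U] [SMulCommClass R S U]

lemma ses_ker {A B : Type} [AddCommGroup A] [Module R A] [AddCommGroup B] [Module R B]
    (f : A →ₗ[R] B) (hf : Function.Surjective f) : SES (LinearMap.ker f).subtype f :=
  ⟨Subtype.val_injective, LinearMap.exact_subtype_ker_map f, hf⟩

lemma ses_quot {A : Type} [AddCommGroup A] [Module R A] (p : Submodule R A) :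
    SES p.subtype p.mkQ :=
  ⟨Subtype.val_injective, LinearMap.exact_subtype_mkQ p, p.mkQ_surjective⟩

lemma cover_surj (M : Type) [AddCommGroup M] [Module R M] : Function.Surjective (cover R M) :=
  fun m => ⟨Finsupp.single m 1, by simp [cover]⟩

lemma syz_equiv (M : ModuleCat.{0} R) (n : ℕ) : ∀ m k, k = n + m + 1 →
    Nonempty (E R S U (syz R M n) (m + 1) ≃ₗ[S] E R S U M k) := by
  induction n with
  | zero =>
    rintro m k rfl
    rw [zero_add]
    exact ⟨LinearEquiv.refl _ _⟩
  | succ n ih =>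
    rintro m k hk
    obtain ⟨e⟩ := ih (m + 1) k (by omega)
    exact ⟨((ses_ker R _ (cover_surj R (syz R M n))).shift S U (m + 1)
      (proj_zero S U m) (proj_zero S U (m + 1))).trans e⟩

lemma ExtU_equiv (M : ModuleCat.{0} R) (n : ℕ) :
    Nonempty (ExtU R S U M n ≃ₗ[S] E R S U M n) := by
  cases n with
  | zero => exact ⟨(E0 R S U M).symm⟩
  | succ n =>
    obtain ⟨e⟩ := syz_equiv R S U M n 0 (n + 1) rfl
    obtain ⟨e'⟩ := (ses_ker R _ (cover_surj R (syz R M n))).ext1 S U (proj_zero S U 0)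
    exact ⟨LinearEquiv.trans (M₂ := E R S U (syz R M n) (0 + 1)) e' e⟩

end Compare

section Resolution

/-- A resolution of `M` by finitely generated free modules. -/
structure Res (R : Type) [Ring R] (M : Type) [AddCommGroup M] [Module R M] where
  r : ℕ → ℕ
  d : ∀ n, (Fin (r (n + 1)) → R) →ₗ[R] (Fin (r n) → R)
  ε : (Fin (r 0) → R) →ₗ[R] M
  surj : Function.Surjective ε
  ex0 : Function.Exact (d 0) ε
  ex : ∀ n, Function.Exact (d (n + 1)) (d n)

variable {R : Type} [Ring R] 

/-- chosen free cover of finite module -/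
lemma exists_cover [IsNoetherianRing R] (M : ModuleCat.{0} R) (hM : Module.Finite R M) :
    ∃ (r : ℕ) (f : (Fin r → R) →ₗ[R] M), Function.Surjective f :=
  Module.Finite.exists_fin' R M

variable (R) in
/-- Bundled finite modules. -/
def FM := {M : ModuleCat.{0} R // Module.Finite R M}

section
variable [IsNoetherianRing R]

/-- Rank of the chosen cover. -/
def FM.rk (M : FM R) : ℕ := (exists_cover M.1 M.2).choose

/-- The chosen cover. -/
def FM.cov (M : FM R) : (Fin M.rk → R) →ₗ[R] M.1 := (exists_cover M.1 M.2).choose_spec.choose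

lemma FM.cov_surj (M : FM R) : Function.Surjective M.cov :=
  (exists_cover M.1 M.2).choose_spec.choose_spec

/-- The chosen syzygy. -/
def FM.next (M : FM R) : FM R := ⟨ModuleCat.of R (LinearMap.ker M.cov), by
  change Module.Finite R (LinearMap.ker M.cov)
  infer_instance⟩

/-- Iterated syzygies. -/
def FM.iter (M : FM R) : ℕ → FM R
  | 0 => M
  | n + 1 => (FM.iter M n).next

lemma exact_comp_subtype {A B C : Type} [AddCommGroup A] [Module R A] [AddCommGroup B]
    [Module R B] [AddCommGroup C] [Module R C] (g : B →ₗ[R] C)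
    (c : A →ₗ[R] LinearMap.ker g) (hc : Function.Surjective c) :
    Function.Exact ((LinearMap.ker g).subtype.comp c) g := by
  intro y
  constructor
  · intro h
    obtain ⟨x, hx⟩ := hc ⟨y, h⟩
    exact ⟨x, by simp [hx]⟩
  · rintro ⟨x, rfl⟩
    exact (c x).2

lemma exists_res (M : Type) [AddCommGroup M] [Module R M] (hM : Module.Finite R M) :
    Nonempty (Res R M) := by
  let M0 : FM R := ⟨ModuleCat.of R M, hM⟩
  refine ⟨{ r := fun n => (M0.iter n).rk
            d := fun n => (LinearMap.ker (M0.iter n).cov).subtype.comp (M0.iter n).next.cov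
            ε := M0.cov
            surj := M0.cov_surj
            ex0 := exact_comp_subtype M0.cov M0.next.cov M0.next.cov_surj
            ex := fun n => ?_ }⟩
  have := exact_comp_subtype (M0.iter (n + 1)).cov (M0.iter (n + 1)).next.cov
    (M0.iter (n + 1)).next.cov_surj
  intro y
  refine Iff.trans ?_ (this y)
  exact (Subtype.ext_iff (a1 := ((M0.iter n).next.cov y : LinearMap.ker (M0.iter n).cov)) (a2 := 0)).symm
end

variable {M : Type} [AddCommGroup M] [Module R M]

/-- The first cover of the syzygy. -/
def Res.π (P : Res R M) : (Fin (P.r 1) → R) →ₗ[R] LinearMap.ker P.ε :=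
  (P.d 0).codRestrict _ (fun x => (P.ex0 _).2 ⟨x, rfl⟩)

lemma Res.π_surj (P : Res R M) : Function.Surjective P.π := by
  rintro ⟨y, hy⟩
  obtain ⟨x, hx⟩ := (P.ex0 y).1 hy
  exact ⟨x, Subtype.ext hx⟩

lemma Res.π_exact (P : Res R M) : Function.Exact (P.d 1) P.π := by
  intro y
  rw [← P.ex 0 y]
  exact Subtype.ext_iff

/-- The resolution of the first syzygy. -/
def Res.shift (P : Res R M) : Res R (LinearMap.ker P.ε) where
  r n := P.r (n + 1)
  d n := P.d (n + 1)
  ε := P.π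
  surj := P.π_surj
  ex0 := P.π_exact
  ex n := P.ex (n + 1)

variable (S : Type) [Ring S]
variable (U : Type) [AddCommGroup U] [Module R U] [Module S U] [SMulCommClass R S U]

variable (R) in
/-- Dual of a free module. -/
abbrev D (r : ℕ) := (Fin r → R) →ₗ[R] U

/-- The dual differential. -/
def Res.dd (P : Res R M) (n : ℕ) : D R U (P.r n) →ₗ[S] D R U (P.r (n + 1)) :=
  precompS R S U (P.d n)

lemma Res.dd_apply (P : Res R M) (n : ℕ) (f : D R U (P.r n)) :
    P.dd S U n f = f.comp (P.d n) := rfl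

lemma Res.dd_dd (P : Res R M) (n : ℕ) (f : D R U (P.r n)) :
    P.dd S U (n + 1) (P.dd S U n f) = 0 := by
  rw [Res.dd_apply, Res.dd_apply, LinearMap.comp_assoc, (P.ex n).linearMap_comp_eq_zero,
    LinearMap.comp_zero]

/-- The cokernel of the dual differential. -/
abbrev Res.X (P : Res R M) (n : ℕ) := D R U (P.r (n + 1)) ⧸ LinearMap.range (P.dd S U n)

/-- The image of the dual differential. -/
abbrev Res.I (P : Res R M) (n : ℕ) := LinearMap.range (P.dd S U n)

/-- `X n → I (n+1)` -/
def Res.g (P : Res R M) (n : ℕ) : P.X S U n →ₗ[S] P.I S U (n + 1) :=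
  (LinearMap.range (P.dd S U n)).liftQ (P.dd S U (n + 1)).rangeRestrict (by
    rintro _ ⟨f, rfl⟩
    exact Subtype.ext (P.dd_dd S U n f))

lemma Res.g_mk (P : Res R M) (n : ℕ) (f) : P.g S U n (Submodule.Quotient.mk f) =
  (P.dd S U (n + 1)).rangeRestrict f := rfl

lemma Res.g_surj (P : Res R M) (n : ℕ) : Function.Surjective (P.g S U n) := by
  rintro ⟨_, ⟨f, rfl⟩⟩
  exact ⟨Submodule.Quotient.mk f, rfl⟩

/-- Cohomology of the dual complex. -/
abbrev Res.A (P : Res R M) (n : ℕ) := LinearMap.ker (P.g S U n)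

lemma Res.ses1 (P : Res R M) (n : ℕ) : SES (P.A S U n).subtype (P.g S U n) :=
  ses_ker S _ (P.g_surj S U n)

lemma Res.ses2 (P : Res R M) (n : ℕ) : SES (P.I S U n).subtype (P.I S U n).mkQ :=
  ses_quot S _

lemma factor_surj {A B : Type} [AddCommGroup A] [Module R A] [AddCommGroup B] [Module R B]
    (p : A →ₗ[R] B) (hp : Function.Surjective p) (f : A →ₗ[R] U)
    (hf : LinearMap.ker p ≤ LinearMap.ker f) : ∃ h : B →ₗ[R] U, h.comp p = f := by
  refine ⟨((LinearMap.ker p).liftQ f hf).comp (p.quotKerEquivOfSurjective hp).symm.toLinearMap, ?_⟩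
  ext a
  have : (p.quotKerEquivOfSurjective hp).symm (p a) = Submodule.Quotient.mk a := by
    rw [LinearEquiv.symm_apply_eq]; rfl
  simp [this]

lemma Res.A_equiv0 (P : Res R M) : Nonempty (E R S U M 1 ≃ₗ[S] P.A S U 0) := by
  obtain ⟨e⟩ := (ses_ker R P.ε P.surj).ext1 S U (proj_zero S U 0)
  let φ : (LinearMap.ker P.ε →ₗ[R] U) →ₗ[S] P.A S U 0 :=
    ((LinearMap.range (P.dd S U 0)).mkQ.comp (precompS R S U P.π)).codRestrict _ (by
      intro f
      apply Subtype.ext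
      change (f.comp P.π).comp (P.d 1) = 0
      rw [LinearMap.comp_assoc, P.π_exact.linearMap_comp_eq_zero, LinearMap.comp_zero])
  have hs : Function.Surjective φ := by
    rintro ⟨a, ha⟩
    obtain ⟨f, rfl⟩ := Submodule.Quotient.mk_surjective _ a
    have hf : f.comp (P.d 1) = 0 := congrArg Subtype.val ha
    obtain ⟨h, hh⟩ := factor_surj U P.π P.π_surj f (by
      intro x hx
      obtain ⟨y, rfl⟩ := (P.π_exact x).1 hx
      exact LinearMap.congr_fun hf y)
    exact ⟨h, Subtype.ext (congrArg Submodule.Quotient.mk hh)⟩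
  have hk : LinearMap.ker φ = LinearMap.range (precompS R S U (LinearMap.ker P.ε).subtype) := by
    ext f
    have h1 : f ∈ LinearMap.ker φ ↔ f.comp P.π ∈ LinearMap.range (P.dd S U 0) := by
      rw [LinearMap.mem_ker, ← Submodule.Quotient.mk_eq_zero]
      exact Subtype.ext_iff
    rw [h1]
    constructor
    · rintro ⟨h, hh⟩
      refine ⟨h, ?_⟩
      change h.comp (LinearMap.ker P.ε).subtype = f
      ext x
      obtain ⟨y, rfl⟩ := P.π_surj x
      exact LinearMap.congr_fun hh y
    · rintro ⟨h, rfl⟩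
      exact ⟨h, rfl⟩
  exact ⟨e.symm.trans ((Submodule.quotEquivOfEq _ _ hk.symm).trans
    (φ.quotKerEquivOfSurjective hs))⟩

lemma Res.A_equiv (n : ℕ) : ∀ {M : Type} [AddCommGroup M] [Module R M] (P : Res R M),
    Nonempty (E R S U M (n + 1) ≃ₗ[S] P.A S U n) := by
  induction n with
  | zero => intro M _ _ P; exact P.A_equiv0 S U
  | succ n ih =>
    intro M _ _ P
    obtain ⟨e⟩ := ih P.shift
    exact ⟨((ses_ker R P.ε P.surj).shift S U (n + 1) (proj_zero S U n)
      (proj_zero S U (n + 1))).symm.trans e⟩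

/-- iterated syzygies -/
lemma exists_syz [IsNoetherianRing R] (m : ℕ) :
    ∀ (M : Type) [AddCommGroup M] [Module R M] (_ : Module.Finite R M) (n : ℕ), ∃ K : ModuleCat.{0} R,
    Module.Finite R K ∧ Nonempty (E R S U K (n + 1) ≃ₗ[S] E R S U M (m + n + 1)) := by
  induction m with
  | zero =>
    intro M _ _ hM n
    rw [zero_add]
    exact ⟨ModuleCat.of R M, hM, ⟨LinearEquiv.refl _ _⟩⟩
  | succ m ih =>
    intro M _ _ hM n
    obtain ⟨P⟩ := exists_res M hM
    obtain ⟨K, hK, ⟨e⟩⟩ := ih (LinearMap.ker P.ε) inferInstance n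
    have e2 := ((ses_ker R P.ε P.surj).shift S U (m + n + 1) (proj_zero S U (m + n))
      (proj_zero S U (m + n + 1)))
    rw [show m + 1 + n + 1 = m + n + 1 + 1 by omega]
    exact ⟨K, hK, ⟨e.trans e2⟩⟩

end Resolution
end PartP2

section PartP3a
section Duality

variable {R : Type} [Ring R] {S : Type} [Ring S]
variable {U : Type} [AddCommGroup U] [Module R U] [Module S U]
  [SMulCommClass R S U] [SMulCommClass S R U]

variable (R S U) in
/-- evaluation at a basis vector -/
def Dp (r : ℕ) (i : Fin r) : D R U r →ₗ[S] U where
  toFun f := f (Pi.single i 1)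
  map_add' _ _ := rfl
  map_smul' _ _ := rfl

variable (R S U) in
/-- the coordinate inclusion -/
def Dq (r : ℕ) (i : Fin r) : U →ₗ[S] D R U r where
  toFun u := (LinearMap.toSpanSingleton R U u).comp (LinearMap.proj i)
  map_add' u v := by ext; simp
  map_smul' s u := by
    ext
    simp only [LinearMap.comp_apply, LinearMap.smul_apply, LinearMap.toSpanSingleton_apply,
      RingHom.id_apply]
    exact smul_comm _ _ _

lemma D_id (r : ℕ) : ∑ i, (Dq R S U r i).comp (Dp R S U r i) = LinearMap.id := by
  ext f j
  simp [Dq, Dp, LinearMap.sum_apply, Pi.single_apply]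

lemma D_zero (n : ℕ) (h : Subsingleton (E S R U U n)) (r : ℕ) :
    Subsingleton (E S R U (D R U r) n) :=
  sum_zero R U n h r _ _ (D_id r)

lemma D_cov (T : Type) [AddCommGroup T] [Module S T] (n : ℕ) (h : Subsingleton (E S R U T n))
    (r : ℕ) : Subsingleton (E S R (D R U r) T n) :=
  cov_sum_zero R n h r _ _ (D_id r)

lemma D_finite [Module.Finite S U] (r : ℕ) : Module.Finite S (D R U r) := by
  refine Module.Finite.of_surjective (∑ i, (Dq R S U r i).comp (LinearMap.proj i) :
    (Fin r → U) →ₗ[S] D R U r) ?_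
  intro f
  refine ⟨fun i => Dp R S U r i f, ?_⟩
  have := LinearMap.congr_fun (D_id (R := R) (S := S) (U := U) r) f
  simpa [LinearMap.sum_apply] using this

lemma bid_surj (hb : ∀ φ : U →ₗ[S] U, ∃ a : R, ∀ u, φ u = a • u) (r : ℕ)
    (φ : D R U r →ₗ[S] U) : ∃ p : Fin r → R, ∀ f, φ f = f p := by
  choose p hp using fun i => hb (φ.comp (Dq R S U r i))
  refine ⟨p, fun f => ?_⟩
  have h := LinearMap.congr_fun (D_id (R := R) (S := S) (U := U) r) f
  have h2 := congrArg φ h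
  simp only [LinearMap.sum_apply, map_sum, LinearMap.comp_apply, LinearMap.id_apply] at h2
  rw [← h2]
  simp only [LinearMap.comp_apply] at hp
  simp only [hp]
  conv_rhs => rw [pi_eq_sum_univ' p]
  simp only [map_sum]
  refine Finset.sum_congr rfl fun i _ => ?_
  simp only [Dp, LinearMap.coe_mk, AddHom.coe_mk]
  rw [← map_smul]

lemma bid_inj (hf : ∀ a : R, (∀ u : U, a • u = 0) → a = 0) (r : ℕ) (p : Fin r → R)
    (hp : ∀ f : D R U r, f p = 0) : p = 0 := by
  funext i
  refine hf _ fun u => ?_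
  exact hp ((LinearMap.toSpanSingleton R U u).comp (LinearMap.proj i))

end Duality
end PartP3a

section PartP3b
section Core

variable (R : Type) [Ring R] (S : Type) [Ring S]
variable (U : Type) [AddCommGroup U] [Module R U] [Module S U]
  [SMulCommClass R S U] [SMulCommClass S R U]

/-- standing hypotheses on the bimodule -/
structure Hyp : Prop where
  bal : ∀ φ : U →ₗ[S] U, ∃ a : R, ∀ u, φ u = a • u
  faith : ∀ a : R, (∀ u : U, a • u = 0) → a = 0
  orth : ∀ n, Subsingleton (E S R U U (n + 1))

/-- the grade condition -/
def G (j : ℕ) : Prop := ∀ (M : Type) [AddCommGroup M] [Module R M], Module.Finite R M →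
  ∀ t < j, Subsingleton (E S R U (E R S U M (j + 1)) t)

/-- the vanishing condition -/
def V (j : ℕ) : Prop := ∀ (M : Type) [AddCommGroup M] [Module R M], Module.Finite R M →
  Subsingleton (E S R U (E R S U M (j + 1)) (j - 1))

variable {R S U}

lemma G_of_V [IsNoetherianRing R] (m : ℕ) (h : ∀ j, 1 ≤ j → j ≤ m → V R S U j) (j : ℕ) (h1 : 1 ≤ j)
    (hj : j ≤ m) : G R S U j := by
  intro M _ _ hM t ht
  obtain ⟨K, hK, ⟨e⟩⟩ := exists_syz S U (j - (t + 1)) M hM (t + 1)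
  have hv := h (t + 1) (by omega) (by omega) K hK
  rw [show j - (t + 1) + (t + 1) = j by omega] at e
  rw [show t + 1 - 1 = t by omega] at hv
  exact (pullEquiv R U e t).symm.toEquiv.symm.subsingleton

lemma Res.X_finite [Module.Finite S U] {M : Type} [AddCommGroup M] [Module R M] (P : Res R M)
    (n : ℕ) : Module.Finite S (P.X S U n) := by
  have := D_finite (R := R) (S := S) (U := U) (P.r (n + 1))
  infer_instance

/-- a functional on the dual complex killing boundaries comes from a boundary -/
lemma Res.ev (H : Hyp R S U) {M : Type} [AddCommGroup M] [Module R M] (P : Res R M) (n : ℕ)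
    (φ : D R U (P.r (n + 1)) →ₗ[S] U) (hφ : ∀ f, φ (P.dd S U n f) = 0) :
    ∃ q, ∀ f, φ f = P.dd S U (n + 1) f q := by
  obtain ⟨p, hp⟩ := bid_surj H.bal _ φ
  have h0 : P.d n p = 0 := bid_inj H.faith _ _ fun f => by
    have := hφ f
    rw [hp] at this
    exact this
  obtain ⟨q, hq⟩ := (P.ex n p).1 h0
  refine ⟨q, fun f => ?_⟩
  rw [hp, ← hq]
  rfl

lemma Res.E1 (H : Hyp R S U) {M : Type} [AddCommGroup M] [Module R M] (P : Res R M) (n : ℕ) :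
    Subsingleton (E S R U (P.X S U (n + 1)) 1) := by
  refine subsingleton_of_forall_eq 0 fun e => ?_
  have hD := D_zero (R := R) (S := S) (U := U) 1 (H.orth 0) (P.r (n + 2))
  obtain ⟨x, rfl⟩ := (P.ses2 S U (n + 1)).ex3 R U 0 e (Subsingleton.elim _ _)
  obtain ⟨φ, rfl⟩ := (E0 S R U _).symm.surjective x
  obtain ⟨q, hq⟩ := P.ev H n (φ.comp (P.dd S U (n + 1)).rangeRestrict) (by
    intro f
    have : (P.dd S U (n + 1)).rangeRestrict (P.dd S U n f) = 0 := Subtype.ext (P.dd_dd S U n f)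
    rw [LinearMap.comp_apply, this, map_zero])
  let ψ : D R U (P.r (n + 2)) →ₗ[S] U :=
    { toFun := fun f => f q
      map_add' := fun _ _ => rfl
      map_smul' := fun _ _ => rfl }
  have hφ : φ = ψ.comp (P.I S U (n + 1)).subtype := by
    apply LinearMap.ext
    rintro ⟨_, ⟨f, rfl⟩⟩
    exact hq f
  rw [hφ, ← E0_symm_pull]
  exact SES.δ_pull _ _ _ _ _

lemma Res.pull0 (H : Hyp R S U) {M : Type} [AddCommGroup M] [Module R M] (P : Res R M) (n : ℕ)
    (e : E S R U (P.X S U n) 0) : pull R U (P.A S U n).subtype 0 e = 0 := by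
  obtain ⟨ψ, rfl⟩ := (E0 S R U _).symm.surjective e
  rw [E0_symm_pull]
  suffices ψ.comp (P.A S U n).subtype = 0 by rw [this, map_zero]
  obtain ⟨q, hq⟩ := P.ev H n (ψ.comp (P.I S U n).mkQ) (by
    intro f
    have : (P.I S U n).mkQ (P.dd S U n f) = 0 :=
      (Submodule.Quotient.mk_eq_zero _).2 ⟨f, rfl⟩
    rw [LinearMap.comp_apply, this, map_zero])
  apply LinearMap.ext
  rintro ⟨a, ha⟩
  obtain ⟨f, rfl⟩ := Submodule.Quotient.mk_surjective _ a
  have h2 := hq f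
  have h3 : P.dd S U (n + 1) f = 0 := congrArg Subtype.val ha
  rw [h3] at h2
  exact h2

lemma T_lemma [IsNoetherianRing R] (H : Hyp R S U) {M : Type} [AddCommGroup M] [Module R M]
    (hM : Module.Finite R M) (P : Res R M) (i : ℕ) :
    (∀ j, 1 ≤ j → j < i → G R S U j) → ∀ t, 1 ≤ t → t ≤ i →
      Subsingleton (E S R U (P.X S U i) t) := by
  induction i with
  | zero => intro _ t h1 h2; omega
  | succ i ih =>
    intro hG t h1 h2
    obtain rfl | ht := eq_or_lt_of_le h1
    · exact P.E1 H i
    obtain ⟨t, rfl⟩ := Nat.exists_eq_add_of_le' ht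
    change Subsingleton (E S R U (P.X S U (i + 1)) (t + 1 + 1))
    have hX := ih (fun j h1 h2 => hG j h1 (by omega)) (t + 1) (by omega) (by omega)
    obtain ⟨e⟩ := P.A_equiv S U i
    have hA : Subsingleton (E S R U (P.A S U i) t) := by
      have := hG i (by omega) (by omega) M hM t (by omega)
      exact (pullEquiv R U e t).toEquiv.subsingleton
    have hI : Subsingleton (E S R U (P.I S U (i + 1)) (t + 1)) := by
      refine subsingleton_of_forall_eq 0 fun x => ?_
      obtain ⟨y, rfl⟩ := (P.ses1 S U i).ex3 R U t x (Subsingleton.elim _ _)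
      rw [Subsingleton.elim y 0, map_zero]
    have hD := D_zero (R := R) (S := S) (U := U) (t + 2) (H.orth (t + 1)) (P.r (i + 2))
    refine subsingleton_of_forall_eq 0 fun x => ?_
    obtain ⟨y, rfl⟩ := (P.ses2 S U (i + 1)).ex3 R U (t + 1) x (Subsingleton.elim _ _)
    rw [Subsingleton.elim y 0, map_zero]

/-- `X m → D (m+2)` -/
def Res.w {M : Type} [AddCommGroup M] [Module R M] (P : Res R M) (m : ℕ) :
    P.X S U m →ₗ[S] D R U (P.r (m + 2)) := (P.I S U (m + 1)).subtype.comp (P.g S U m)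

lemma Res.ses3 {M : Type} [AddCommGroup M] [Module R M] (P : Res R M) (m : ℕ)
    (h : Subsingleton (E R S U M (m + 1))) :
    SES (P.w (S := S) (U := U) m) (P.I S U (m + 1)).mkQ := by
  refine ⟨?_, ?_, (P.ses2 S U (m + 1)).surj⟩
  · refine Subtype.val_injective.comp ?_
    change Function.Injective (P.g S U m)
    obtain ⟨e⟩ := P.A_equiv S U m
    have := e.symm.toEquiv.subsingleton
    rw [← LinearMap.ker_eq_bot]
    exact Submodule.subsingleton_iff_eq_bot.1 this
  · intro y
    rw [(P.ses2 S U (m + 1)).ex y]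
    constructor
    · rintro ⟨x, rfl⟩
      obtain ⟨z, rfl⟩ := P.g_surj S U m x
      exact ⟨z, rfl⟩
    · rintro ⟨z, rfl⟩
      exact ⟨P.g S U m z, rfl⟩

lemma Res.ses4 {M : Type} [AddCommGroup M] [Module R M] (P : Res R M)
    (h : Subsingleton (E R S U M 0)) :
    SES (P.dd S U 0) (P.I S U 0).mkQ := by
  refine ⟨?_, ?_, (P.ses2 S U 0).surj⟩
  · rw [injective_iff_map_eq_zero]
    intro f hf
    obtain ⟨k, rfl⟩ := factor_surj U P.ε P.surj f (by
      intro x hx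
      obtain ⟨y, rfl⟩ := (P.ex0 x).1 hx
      exact LinearMap.congr_fun hf y)
    have : Subsingleton (M →ₗ[R] U) := (E0 R S U M).symm.toEquiv.subsingleton
    rw [Subsingleton.elim k 0, LinearMap.zero_comp]
  · intro y
    rw [(P.ses2 S U 0).ex y]
    constructor
    · rintro ⟨⟨_, ⟨z, rfl⟩⟩, rfl⟩
      exact ⟨z, rfl⟩
    · rintro ⟨z, rfl⟩
      exact ⟨⟨_, ⟨z, rfl⟩⟩, rfl⟩

lemma X_cov {M : Type} [AddCommGroup M] [Module R M] (P : Res R M) (C : Type) [AddCommGroup C]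
    [Module S C] (n : ℕ) (hM : ∀ j < n, Subsingleton (E R S U M j))
    (hC : ∀ j ≤ n, Subsingleton (E S R U C j)) (m : ℕ) :
    ∀ j, j + m + 1 ≤ n → Subsingleton (E S R (P.X S U m) C j) := by
  induction m with
  | zero =>
    intro j hj
    exact cov_zero (P.ses4 (hM 0 (by omega))) R j (D_cov C j (hC j (by omega)) _)
      (D_cov C (j + 1) (hC _ (by omega)) _)
  | succ m ih =>
    intro j hj
    exact cov_zero (P.ses3 m (hM _ (by omega))) R j (D_cov C j (hC j (by omega)) _)
      (ih (j + 1) (by omega))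

lemma hom_zero {C X : Type} [AddCommGroup C] [Module S C] [AddCommGroup X] [Module S X]
    (h : Subsingleton (E S R X C 0)) (f : C →ₗ[S] X) : f = 0 := by
  have : Subsingleton (E S ℤ X C 0) := h
  exact (E0 S ℤ X C).symm.injective (Subsingleton.elim _ _)

lemma zeroC [IsNoetherianRing R] {M : Type} [AddCommGroup M] [Module R M] (hf : Module.Finite R M)
    (n : ℕ) (hM : ∀ j < n, Subsingleton (E R S U M j))
    (hC : ∀ j ≤ n, Subsingleton (E S R U (E R S U M n) j)) : Subsingleton (E R S U M n) := by
  cases n with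
  | zero =>
    have h0 := hC 0 le_rfl
    refine subsingleton_of_forall_eq 0 fun c => ?_
    apply (E0 R S U M).injective
    rw [map_zero]
    ext m
    let ψ : E R S U M 0 →ₗ[S] U :=
      { toFun := fun c => E0 R S U M c m
        map_add' := fun _ _ => by simp
        map_smul' := fun _ _ => by simp }
    have : ψ = 0 := hom_zero h0 ψ
    exact LinearMap.congr_fun this c
  | succ n =>
    obtain ⟨P⟩ := exists_res M hf
    obtain ⟨e⟩ := P.A_equiv S U n
    have := X_cov P (E R S U M (n + 1)) (n + 1) hM hC n 0 (by omega)
    have h0 := hom_zero this ((P.A S U n).subtype.comp e.toLinearMap)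
    refine subsingleton_of_forall_eq 0 fun c => ?_
    apply e.injective
    rw [map_zero]
    exact Subtype.ext (LinearMap.congr_fun h0 c)

lemma core [IsNoetherianRing R] [IsNoetherianRing S] [Module.Finite S U]
    (H : Hyp R S U) (i : ℕ) (hi : 1 ≤ i)
    (hG : ∀ j, 1 ≤ j → j < i → G R S U j) (hG' : G S R U i) : V R S U i := by
  intro M _ _ hM
  obtain ⟨i, rfl⟩ := Nat.exists_eq_add_of_le' hi
  rw [show i + 1 - 1 = i by omega]
  obtain ⟨P⟩ := exists_res M hM
  obtain ⟨e⟩ := P.A_equiv S U (i + 1)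
  have hXf := P.X_finite (S := S) (U := U) (i + 1)
  have hXf' := P.X_finite (S := S) (U := U) (i + 2)
  have hAf : Module.Finite S (P.A S U (i + 1)) := by infer_instance
  have T := T_lemma H hM P (i + 1) hG
  suffices h : Subsingleton (E S R U (P.A S U (i + 1)) i) from
    (pullEquiv R U e i).symm.toEquiv.subsingleton
  refine zeroC hAf i ?_ ?_
  · intro j hj
    obtain ⟨K, hK, ⟨e'⟩⟩ := exists_syz S U 1 M hM i
    rw [show 1 + i + 1 = i + 1 + 1 by omega] at e'
    have := hG i (by omega) (by omega) K hK j hj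
    exact (pullEquiv R U (e'.trans e) j).toEquiv.subsingleton
  · have hD := fun t => D_zero (R := R) (S := S) (U := U) _ (H.orth t) (P.r (i + 3))
    have e2 := (P.ses2 S U (i + 2)).shift R U (i + 1) (hD i) (hD (i + 1))
    have e1 : E S R U (P.A S U (i + 1)) i ≃ₗ[R] E S R U (P.I S U (i + 2)) (i + 1) :=
      LinearEquiv.ofBijective ((P.ses1 S U (i + 1)).δ R U i) ⟨by
        rw [injective_iff_map_eq_zero]
        intro x hx
        obtain ⟨y, rfl⟩ := (P.ses1 S U (i + 1)).ex1 R U i x hx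
        cases i with
        | zero => exact P.pull0 H _ y
        | succ i =>
          have := T (i + 1) (by omega) (by omega)
          rw [Subsingleton.elim y 0, map_zero], by
        intro x
        have := T (i + 1) (by omega) (by omega)
        exact (P.ses1 S U (i + 1)).ex3 R U i x (Subsingleton.elim _ _)⟩
    have ee := e1.trans e2
    intro j hj
    have := hG' (P.X S U (i + 2)) hXf' j (by omega)
    exact (pullEquiv S U ee j).symm.toEquiv.subsingleton

lemma main_step [IsNoetherianRing R] [IsNoetherianRing S] [Module.Finite S U]
    (H : Hyp R S U) (m : ℕ) (hG' : ∀ j, 1 ≤ j → j ≤ m → G S R U j) (j : ℕ) :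
    1 ≤ j → j ≤ m → V R S U j := by
  induction j using Nat.strong_induction_on with
  | _ j ih =>
    intro h1 h2
    refine core H j h1 ?_ (hG' j h1 h2)
    intro l hl hlj
    exact G_of_V (j - 1) (fun a ha hb => ih a (by omega) ha (by omega)) l hl (by omega)

end Core
end PartP3b

section PartP4
section Translate

lemma vanish_iff (R : Type) [Ring R] (S : Type) [Ring S]
    (U : Type) [AddCommGroup U] [Module R U] [Module S U] [SMulCommClass R S U]
    (M : ModuleCat.{0} R) (n : ℕ) :
    extVanish R S U M n ↔ Subsingleton (E R S U M n) := by
  obtain ⟨e⟩ := ExtU_equiv R S U M n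
  exact ⟨fun h => have : Subsingleton (ExtU R S U M n) := h
    e.symm.toEquiv.subsingleton, fun h => e.toEquiv.subsingleton⟩

lemma vanish_iff2 (R : Type) [Ring R] (S : Type) [Ring S]
    (U : Type) [AddCommGroup U] [Module R U] [Module S U] [SMulCommClass R S U]
    [SMulCommClass S R U] (M : ModuleCat.{0} R) (n j : ℕ) :
    extVanish S R U (ModuleCat.of S (ExtU R S U M n)) j ↔
      Subsingleton (E S R U (E R S U M n) j) := by
  rw [vanish_iff]
  obtain ⟨e⟩ := ExtU_equiv R S U M n
  have e2 := pullEquiv R U e j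
  exact ⟨fun h => have : Subsingleton (E S R U (ExtU R S U M n) j) := h
    e2.toEquiv.subsingleton, fun h => e2.symm.toEquiv.subsingleton⟩

lemma G_iff (R : Type) [Ring R] (S : Type) [Ring S]
    (U : Type) [AddCommGroup U] [Module R U] [Module S U] [SMulCommClass R S U]
    [SMulCommClass S R U] (m : ℕ) :
    (∀ M : ModuleCat.{0} R, Module.Finite R ↥M → ∀ i, 1 ≤ i → i ≤ m →
        gradeGE S R U (ModuleCat.of S (ExtU R S U M (i + 1))) i) ↔
      ∀ j, 1 ≤ j → j ≤ m → G R S U j :=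
  ⟨fun h j h1 h2 M _ _ hM t ht =>
    (vanish_iff2 R S U (ModuleCat.of R M) _ _).1 (h (ModuleCat.of R M) hM j h1 h2 t ht),
   fun h M hM j h1 h2 t ht => (vanish_iff2 R S U M _ _).2 (h j h1 h2 M hM t ht)⟩

lemma V_iff (R : Type) [Ring R] (S : Type) [Ring S]
    (U : Type) [AddCommGroup U] [Module R U] [Module S U] [SMulCommClass R S U]
    [SMulCommClass S R U] (m : ℕ) :
    (∀ M : ModuleCat.{0} R, Module.Finite R ↥M → ∀ i, 1 ≤ i → i ≤ m →
        extVanish S R U (ModuleCat.of S (ExtU R S U M (i + 1))) (i - 1)) ↔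
      ∀ j, 1 ≤ j → j ≤ m → V R S U j :=
  ⟨fun h j h1 h2 M _ _ hM =>
    (vanish_iff2 R S U (ModuleCat.of R M) _ _).1 (h (ModuleCat.of R M) hM j h1 h2),
   fun h M hM j h1 h2 => (vanish_iff2 R S U M _ _).2 (h j h1 h2 M hM)⟩

lemma V_of_G (R : Type) [Ring R] (S : Type) [Ring S]
    (U : Type) [AddCommGroup U] [Module R U] [Module S U] [SMulCommClass R S U]
    [SMulCommClass S R U] (m : ℕ) (h : ∀ j, 1 ≤ j → j ≤ m → G R S U j) :
    ∀ j, 1 ≤ j → j ≤ m → V R S U j :=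
  fun j h1 h2 M _ _ hM => h j h1 h2 M hM (j - 1) (by omega)

lemma hyp_left (Λ Γ : Type) [Ring Λ] [Ring Γ] (U : Type) [AddCommGroup U] [Module Λ U]
    [Module Γᵐᵒᵖ U] [SMulCommClass Λ Γᵐᵒᵖ U] [SMulCommClass Γᵐᵒᵖ Λ U]
    (hfb : FaithfullyBalanced Λ Γ U) (hso : SelfOrthogonal Λ Γ U) : Hyp Λ Γᵐᵒᵖ U where
  bal φ := by
    obtain ⟨a, ha⟩ := hfb.1.2 φ
    exact ⟨a, fun u => by rw [← ha]; rfl⟩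
  faith a ha := by
    apply hfb.1.1
    apply LinearMap.ext
    intro u
    change a • u = (0 : Λ) • u
    rw [ha, zero_smul]
  orth n := (vanish_iff Γᵐᵒᵖ Λ U (ModuleCat.of Γᵐᵒᵖ U) (n + 1)).1 (hso.2 (n + 1) (by omega))

lemma hyp_right (Λ Γ : Type) [Ring Λ] [Ring Γ] (U : Type) [AddCommGroup U] [Module Λ U]
    [Module Γᵐᵒᵖ U] [SMulCommClass Λ Γᵐᵒᵖ U] [SMulCommClass Γᵐᵒᵖ Λ U]
    (hfb : FaithfullyBalanced Λ Γ U) (hso : SelfOrthogonal Λ Γ U) : Hyp Γᵐᵒᵖ Λ U where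
  bal φ := by
    obtain ⟨a, ha⟩ := hfb.2.2 φ
    exact ⟨a, fun u => by rw [← ha]; rfl⟩
  faith a ha := by
    apply hfb.2.1
    apply LinearMap.ext
    intro u
    change a • u = (0 : Γᵐᵒᵖ) • u
    rw [ha, zero_smul]
  orth n := (vanish_iff Λ Γᵐᵒᵖ U (ModuleCat.of Λ U) (n + 1)).1 (hso.1 (n + 1) (by omega))

end Translate
end PartP4

section Statement

variable (Λ Γ : Type) [Ring Λ] [Ring Γ]
  [IsNoetherianRing Λ] [IsNoetherianRing Λᵐᵒᵖ]
  [IsNoetherianRing Γ] [IsNoetherianRing Γᵐᵒᵖ]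
variable (U : Type) [AddCommGroup U] [Module Λ U] [Module Γᵐᵒᵖ U]
  [SMulCommClass Λ Γᵐᵒᵖ U] [SMulCommClass Γᵐᵒᵖ Λ U]
  [Module.Finite Λ U] [Module.Finite Γᵐᵒᵖ U]

/-- **Lemma 3.3.** For a positive integer `k`, the four grade/Ext-vanishing conditions
(on both sides) are equivalent. -/
theorem grade_ext_tfae (k : ℕ) (hk : 0 < k)
    (hfb : FaithfullyBalanced Λ Γ U) (hso : SelfOrthogonal Λ Γ U) :
    [ (∀ M : ModuleCat.{0} Λ, Module.Finite Λ ↥M → ∀ i, 1 ≤ i → i ≤ k - 1 →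
        gradeGE Γᵐᵒᵖ Λ U (ModuleCat.of Γᵐᵒᵖ (ExtU Λ Γᵐᵒᵖ U M (i + 1))) i),
      (∀ M : ModuleCat.{0} Λ, Module.Finite Λ ↥M → ∀ i, 1 ≤ i → i ≤ k - 1 →
        extVanish Γᵐᵒᵖ Λ U (ModuleCat.of Γᵐᵒᵖ (ExtU Λ Γᵐᵒᵖ U M (i + 1))) (i - 1)),
      (∀ N : ModuleCat.{0} Γᵐᵒᵖ, Module.Finite Γᵐᵒᵖ ↥N → ∀ i, 1 ≤ i → i ≤ k - 1 →
        gradeGE Λ Γᵐᵒᵖ U (ModuleCat.of Λ (ExtU Γᵐᵒᵖ Λ U N (i + 1))) i),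
      (∀ N : ModuleCat.{0} Γᵐᵒᵖ, Module.Finite Γᵐᵒᵖ ↥N → ∀ i, 1 ≤ i → i ≤ k - 1 →
        extVanish Λ Γᵐᵒᵖ U (ModuleCat.of Λ (ExtU Γᵐᵒᵖ Λ U N (i + 1))) (i - 1)) ].TFAE := by
  rw [G_iff, V_iff, G_iff, V_iff]
  have H := hyp_left Λ Γ U hfb hso
  have H' := hyp_right Λ Γ U hfb hso
  tfae_have 1 → 2 := V_of_G _ _ _ _
  tfae_have 3 → 4 := V_of_G _ _ _ _
  tfae_have 2 → 1 := G_of_V _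
  tfae_have 4 → 3 := G_of_V _
  tfae_have 1 → 4 := main_step H' _
  tfae_have 3 → 2 := main_step H _
  tfae_finish

end Statement

end GorPaper
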